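/- Let β ≥ 0 and α > 0, and suppose there exist ρ ∈ (0,1) and a positive semidefinite 2×2 real matrix P̃ such that ρ²X̃₁ + (1−ρ²)X̃₂ − M is positive semidefinite, where Ã := [[1+β, −β],[1, 0]], B̃ := [−α; 0], M is the 3×3 matrix with blocks [[ÃᵀP̃Ã − ρ²P̃, ÃᵀP̃B̃],[B̃ᵀP̃Ã, B̃ᵀP̃B̃]], X̃₁ := [[β²μ/2, −β²μ/2, −β/2],[−β²μ/2, β²μ/2, β/2],[−β/2, β/2, α(1+λ_N^W−Lα)/2]], and X̃₂ := [[(1+β)²μ/2, −β(1+β)μ/2, −(1+β)/2],[−β(1+β)μ/2, β²μ/2, β/2],[−(1+β)/2, β/2, α(1+λ_N^W−Lα)/2]]. Let P := P̃ ⊗ I_{Nd}, T := [1 0] ⊗ I_{Nd}, and V_{P,α,1}(ξ) := ξᵀPξ + F_{W,α}(Tξ + x^∞) − F_{W,α}(x^∞). Then for every k ≥ 0 the D-ASG iterates satisfy E[‖x^{(k)} − x^∞‖²] ≤ ρ^{2k}·2V_{P,α,1}(ξ₀)/μ + (1/(1−ρ²))·(2α²σ²N/μ)·(P̃₁₁ +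 (1−λ_N^W+αL)/(2α)). -/

import Mathlib

open MeasureTheory Filter Real ProbabilityTheory
open scoped RealInnerProductSpace ENNReal NNReal Matrix

/-- The penalized objective `F_{W,α}(x) = (1/(2α)) xᵀ(I−𝒲)x + F(x)`. -/
noncomputable def penObj {N d : ℕ} (W : Matrix (Fin N) (Fin N) ℝ) (α : ℝ)
    (f : Fin N → EuclideanSpace ℝ (Fin d) → ℝ)
    (x : PiLp 2 (fun _ : Fin N => EuclideanSpace ℝ (Fin d))) : ℝ :=
  1 / (2 * α) * ((∑ i, ‖x i‖ ^ 2) - ∑ i, ∑ j, W i j * ⟪x i, x j⟫) + ∑ i, f i (x i)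

/-- The Lyapunov function `V_{P,α,1}(ξ) = ξᵀ(P̃⊗I)ξ + F_{W,α}(Tξ+x^∞) − F_{W,α}(x^∞)`,
written for `ξ = (a, b) ∈ ℝ^{Nd} × ℝ^{Nd}`. -/
noncomputable def lyapP {N d : ℕ} (W : Matrix (Fin N) (Fin N) ℝ) (α : ℝ)
    (Pt : Matrix (Fin 2) (Fin 2) ℝ)
    (f : Fin N → EuclideanSpace ℝ (Fin d) → ℝ)
    (xinf a b : PiLp 2 (fun _ : Fin N => EuclideanSpace ℝ (Fin d))) : ℝ :=
  (Pt 0 0 * ⟪a, a⟫ + Pt 0 1 * ⟪a, b⟫ + Pt 1 0 * ⟪b, a⟫ + Pt 1 1 * ⟪b, b⟫) +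
    penObj W α f (a + xinf) - penObj W α f xinf

theorem Matrix.PosSemidef.sum_mul_inner_nonneg {ι E : Type*} [Fintype ι]
    [NormedAddCommGroup E] [InnerProductSpace ℝ E] {A : Matrix ι ι ℝ} (hA : A.PosSemidef)
    (x : ι → E) : 0 ≤ ∑ i, ∑ j, A i j * ⟪x i, x j⟫ := by
  obtain ⟨m, v, rfl⟩ := Matrix.posSemidef_iff_eq_sum_vecMulVec.mp hA
  have h : ∑ i, ∑ j, (∑ k, Matrix.vecMulVec (v k) (star (v k))) i j * ⟪x i, x j⟫
      = ∑ k, ‖∑ i, v k i • x i‖ ^ 2 := by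
    calc _ = ∑ i, ∑ j, ∑ k, v k i * v k j * ⟪x i, x j⟫ := by
          simp [Matrix.sum_apply, Matrix.vecMulVec_apply, Finset.sum_mul]
      _ = ∑ i, ∑ k, ∑ j, v k i * v k j * ⟪x i, x j⟫ :=
          Finset.sum_congr rfl fun i _ => Finset.sum_comm
      _ = ∑ k, ∑ i, ∑ j, v k i * v k j * ⟪x i, x j⟫ := Finset.sum_comm
      _ = _ := by
          refine Finset.sum_congr rfl fun k _ => ?_
          rw [← real_inner_self_eq_norm_sq, sum_inner]
          simp only [inner_sum, real_inner_smul_left, real_inner_smul_right]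
          exact Finset.sum_congr rfl fun i _ => Finset.sum_congr rfl fun j _ => by ring
  rw [h]
  positivity

theorem hasDerivAt_comp_line {E : Type*} [NormedAddCommGroup E] [InnerProductSpace ℝ E]
    [CompleteSpace E] {f : E → ℝ} {g : E → E} (hg : ∀ x, HasGradientAt f (g x) x) (x d : E)
    (t : ℝ) : HasDerivAt (fun s : ℝ => f (x + s • d)) ⟪g (x + t • d), d⟫ t := by
  have h1 : HasDerivAt (fun s : ℝ => x + s • d) d t := by
    simpa using ((hasDerivAt_id t).smul_const d).const_add x
  convert! (hg (x + t • d)).hasFDerivAt.comp_hasDerivAt t h1 using 1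

/-- The quadratic upper bound for a function with Lipschitz gradient. -/
theorem le_add_inner_add_sq_of_lipschitzWith_gradient {E : Type*} [NormedAddCommGroup E]
    [InnerProductSpace ℝ E] [CompleteSpace E] {f : E → ℝ} {g : E → E} {K : ℝ≥0}
    (hg : ∀ x, HasGradientAt f (g x) x) (hK : LipschitzWith K g) (x y : E) :
    f y ≤ f x + ⟪g x, y - x⟫ + K / 2 * ‖y - x‖ ^ 2 := by
  set d := y - x with hd
  let h : ℝ → ℝ := fun t => f (x + t • d) - t * ⟪g x, d⟫ - K / 2 * ‖d‖ ^ 2 * t ^ 2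
  have hh : ∀ t, HasDerivAt h (⟪g (x + t • d), d⟫ - ⟪g x, d⟫ - K / 2 * ‖d‖ ^ 2 * (2 * t)) t := by
    intro t
    have h2 := ((hasDerivAt_comp_line hg x d t).sub
      ((hasDerivAt_id t).mul_const ⟪g x, d⟫)).sub
      ((hasDerivAt_pow 2 t).const_mul (K / 2 * ‖d‖ ^ 2))
    convert! h2 using 1
    simp
  have hanti : AntitoneOn h (Set.Ici 0) := by
    refine antitoneOn_of_deriv_nonpos (convex_Ici 0)
      (fun t _ => (hh t).continuousAt.continuousWithinAt)
      (fun t _ => (hh t).differentiableAt.differentiableWithinAt) fun t ht => ?_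
    rw [interior_Ici, Set.mem_Ioi] at ht
    rw [(hh t).deriv, ← inner_sub_left]
    have h3 := real_inner_le_norm (g (x + t • d) - g x) d
    have h4 := hK.norm_sub_le (x + t • d) x
    rw [add_sub_cancel_left, norm_smul, Real.norm_of_nonneg ht.le] at h4
    nlinarith [norm_nonneg d]
  have := hanti (Set.mem_Ici.2 le_rfl) (Set.mem_Ici.2 zero_le_one) zero_le_one
  simp only [h, one_smul, zero_smul, add_zero] at this
  rw [hd, add_sub_cancel, ← hd] at this
  linarith

/-- The quadratic lower bound for a strongly convex function. -/
theorem add_inner_add_sq_le_of_convexOn_sub_sq {E : Type*} [NormedAddCommGroup E]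
    [InnerProductSpace ℝ E] [CompleteSpace E] {f : E → ℝ} {g : E → E} {m : ℝ}
    (hg : ∀ x, HasGradientAt f (g x) x)
    (hm : ConvexOn ℝ Set.univ (fun x => f x - m / 2 * ‖x‖ ^ 2)) (x y : E) :
    f x + ⟪g x, y - x⟫ + m / 2 * ‖y - x‖ ^ 2 ≤ f y := by
  set d := y - x with hd
  have hy : y = x + d := by simp [hd]
  have hconv : ConvexOn ℝ Set.univ (fun t : ℝ => f (x + t • d) - m / 2 * ‖x + t • d‖ ^ 2) := by
    have := hm.comp_affineMap (AffineMap.lineMap x y : ℝ →ᵃ[ℝ] E)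
    simpa [Function.comp_def, AffineMap.lineMap_apply, ← hd, add_comm] using this
  have hder : HasDerivAt (fun t : ℝ => f (x + t • d) - m / 2 * ‖x + t • d‖ ^ 2)
      (⟪g x, d⟫ - m * ⟪x, d⟫) 0 := by
    have h1 : HasDerivAt (fun s : ℝ => x + s • d) d 0 := by
      simpa using ((hasDerivAt_id (0 : ℝ)).smul_const d).const_add x
    have h2 := (hasDerivAt_comp_line hg x d 0).sub (h1.norm_sq.const_mul (m / 2))
    simp only [zero_smul, add_zero] at h2
    convert! h2 using 1
    ring
  have := hconv.le_slope_of_hasDerivAt (Set.mem_univ _) (Set.mem_univ _) zero_lt_one hder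
  simp only [slope_def_field, one_smul, zero_smul, add_zero, sub_zero, div_one] at this
  rw [hy]
  rw [norm_add_sq_real] at this
  linarith

section PenalizedObjective

variable {N d : ℕ} {W : Matrix (Fin N) (Fin N) ℝ}

/-- The gradient of the penalized objective `penObj`. -/
noncomputable def penGrad (W : Matrix (Fin N) (Fin N) ℝ) (α : ℝ)
    (gradf : Fin N → EuclideanSpace ℝ (Fin d) → EuclideanSpace ℝ (Fin d))
    (x : PiLp 2 (fun _ : Fin N => EuclideanSpace ℝ (Fin d))) :
    PiLp 2 (fun _ : Fin N => EuclideanSpace ℝ (Fin d)) :=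
  WithLp.toLp 2 fun i => (1 / α) • (x i - ∑ j, W i j • x j) + gradf i (x i)

theorem penObj_eq_add_inner (hW : W.IsSymm) (α : ℝ)
    (f : Fin N → EuclideanSpace ℝ (Fin d) → ℝ)
    (gradf : Fin N → EuclideanSpace ℝ (Fin d) → EuclideanSpace ℝ (Fin d))
    (y z : PiLp 2 (fun _ : Fin N => EuclideanSpace ℝ (Fin d))) :
    penObj W α f z = penObj W α f y + ⟪penGrad W α gradf y, z - y⟫ +
      1 / (2 * α) * (‖z - y‖ ^ 2 - ∑ i, ∑ j, W i j * ⟪(z - y) i, (z - y) j⟫) +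
      ∑ i, (f i (z i) - f i (y i) - ⟪gradf i (y i), z i - y i⟫) := by
  obtain ⟨e, rfl⟩ : ∃ e, z = y + e := ⟨z - y, by simp⟩
  have hsymm : ∑ i, ∑ j, W i j * ⟪e i, y j⟫ = ∑ i, ∑ j, W i j * ⟪y i, e j⟫ := by
    rw [Finset.sum_comm]
    refine Finset.sum_congr rfl fun i _ => Finset.sum_congr rfl fun j _ => ?_
    rw [hW.apply i j, real_inner_comm]
  have hsymm' : ∑ i, ∑ j, W i j * ⟪y j, e i⟫ = ∑ i, ∑ j, W i j * ⟪y i, e j⟫ := by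
    rw [← hsymm]
    simp only [real_inner_comm]
  have hinner : ⟪penGrad W α gradf y, e⟫
      = ∑ i, ⟪(1 / α) • (y i - ∑ j, W i j • y j) + gradf i (y i), e i⟫ := by
    rw [PiLp.inner_apply]; rfl
  rw [add_sub_cancel_left, hinner, PiLp.norm_sq_eq_of_L2]
  simp only [penObj, add_sub_cancel_left, PiLp.add_apply, inner_add_left, inner_add_right,
    norm_add_sq_real, real_inner_smul_left,
    inner_sub_left, sum_inner, Finset.sum_add_distrib, Finset.sum_sub_distrib, mul_add,
    ← Finset.mul_sum, hsymm, hsymm']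
  by_cases hα : α = 0
  · simp [hα]
  · field_simp
    ring

theorem posSemidef_transpose_mul_diagonal_mul {V : Matrix (Fin N) (Fin N) ℝ} {c : Fin N → ℝ}
    (hc : ∀ i, 0 ≤ c i) : (Vᵀ * Matrix.diagonal c * V).PosSemidef := by
  have := (Matrix.PosSemidef.diagonal (d := c) hc).conjTranspose_mul_mul_same V
  simpa using this

theorem norm_sq_sub_sum_nonneg (hW : (1 - W).PosSemidef)
    (x : PiLp 2 (fun _ : Fin N => EuclideanSpace ℝ (Fin d))) :
    0 ≤ ‖x‖ ^ 2 - ∑ i, ∑ j, W i j * ⟪x i, x j⟫ := by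
  have := hW.sum_mul_inner_nonneg fun i => x i
  simpa [sub_mul, Finset.sum_sub_distrib, Matrix.one_apply, PiLp.norm_sq_eq_of_L2] using this

theorem norm_sq_sub_sum_le {l : ℝ} (hW : (W - l • 1).PosSemidef)
    (x : PiLp 2 (fun _ : Fin N => EuclideanSpace ℝ (Fin d))) :
    ‖x‖ ^ 2 - ∑ i, ∑ j, W i j * ⟪x i, x j⟫ ≤ (1 - l) * ‖x‖ ^ 2 := by
  have := hW.sum_mul_inner_nonneg fun i => x i
  simp only [Matrix.sub_apply, Matrix.smul_apply, Matrix.one_apply, smul_eq_mul, sub_mul,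
    Finset.sum_sub_distrib, mul_ite, mul_one, mul_zero, ite_mul, zero_mul, Finset.sum_ite_eq,
    Finset.mem_univ, if_true, real_inner_self_eq_norm_sq, ← Finset.mul_sum,
    ← PiLp.norm_sq_eq_of_L2] at this
  linarith

theorem add_inner_add_sq_le_penObj (hWs : W.IsSymm) (hW : (1 - W).PosSemidef) {α μ : ℝ}
    (hα : 0 < α) {f : Fin N → EuclideanSpace ℝ (Fin d) → ℝ}
    {gradf : Fin N → EuclideanSpace ℝ (Fin d) → EuclideanSpace ℝ (Fin d)}
    (hgrad : ∀ i x, HasGradientAt (f i) (gradf i x) x)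
    (hconv : ∀ i, ConvexOn ℝ Set.univ (fun x => f i x - μ / 2 * ‖x‖ ^ 2))
    (y z : PiLp 2 (fun _ : Fin N => EuclideanSpace ℝ (Fin d))) :
    penObj W α f y + ⟪penGrad W α gradf y, z - y⟫ + μ / 2 * ‖z - y‖ ^ 2 ≤ penObj W α f z := by
  rw [penObj_eq_add_inner hWs α f gradf y z]
  have h1 := mul_nonneg (one_div_nonneg.2 (mul_pos two_pos hα).le)
    (norm_sq_sub_sum_nonneg hW (z - y))
  have h2 : ∑ i, μ / 2 * ‖z i - y i‖ ^ 2
      ≤ ∑ i, (f i (z i) - f i (y i) - ⟪gradf i (y i), z i - y i⟫) :=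
    Finset.sum_le_sum fun i _ => by
      linarith [add_inner_add_sq_le_of_convexOn_sub_sq (hgrad i) (hconv i) (y i) (z i)]
  rw [← Finset.mul_sum] at h2
  have h3 := PiLp.norm_sq_eq_of_L2 _ (z - y)
  simp only [PiLp.sub_apply] at h3
  rw [← h3] at h2
  linarith

theorem penObj_le_add_inner_add_sq (hWs : W.IsSymm) {l : ℝ} (hW : (W - l • 1).PosSemidef)
    {α : ℝ} (hα : 0 < α) {K : ℝ≥0} {f : Fin N → EuclideanSpace ℝ (Fin d) → ℝ}
    {gradf : Fin N → EuclideanSpace ℝ (Fin d) → EuclideanSpace ℝ (Fin d)}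
    (hgrad : ∀ i x, HasGradientAt (f i) (gradf i x) x)
    (hlip : ∀ i, LipschitzWith K (gradf i))
    (y z : PiLp 2 (fun _ : Fin N => EuclideanSpace ℝ (Fin d))) :
    penObj W α f z ≤ penObj W α f y + ⟪penGrad W α gradf y, z - y⟫ +
      ((1 - l) / α + K) / 2 * ‖z - y‖ ^ 2 := by
  rw [penObj_eq_add_inner hWs α f gradf y z]
  have h1 := mul_le_mul_of_nonneg_left (norm_sq_sub_sum_le hW (z - y))
    (one_div_nonneg.2 (mul_pos two_pos hα).le)
  have h2 : ∑ i, (f i (z i) - f i (y i) - ⟪gradf i (y i), z i - y i⟫)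
      ≤ ∑ i, K / 2 * ‖z i - y i‖ ^ 2 :=
    Finset.sum_le_sum fun i _ => by
      linarith [le_add_inner_add_sq_of_lipschitzWith_gradient (hgrad i) (hlip i) (y i) (z i)]
  rw [← Finset.mul_sum] at h2
  have h3 := PiLp.norm_sq_eq_of_L2 _ (z - y)
  simp only [PiLp.sub_apply] at h3
  rw [← h3] at h2
  have h4 : ((1 - l) / α + K) / 2 * ‖z - y‖ ^ 2
      = 1 / (2 * α) * ((1 - l) * ‖z - y‖ ^ 2) + K / 2 * ‖z - y‖ ^ 2 := by
    field_simp
  linarith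

end PenalizedObjective

/-- One step of the Lyapunov recursion, before taking expectations. -/
theorem lyapunov_step_le {E : Type*} [NormedAddCommGroup E] [InnerProductSpace ℝ E]
    {μ L α β ρ lamN c : ℝ} (hρ : ρ ^ 2 ≤ 1) (hc : c * α = 1 - lamN + α * L)
    {Pt : Matrix (Fin 2) (Fin 2) ℝ}
    (hMI :
      (ρ ^ 2 •
            (Matrix.fromBlocks
              !![β ^ 2 * μ / 2, -(β ^ 2 * μ) / 2; -(β ^ 2 * μ) / 2, β ^ 2 * μ / 2]
              !![-β / 2; β / 2] !![-β / 2, β / 2] !![α * (1 + lamN - L * α) / 2]) +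
          (1 - ρ ^ 2) •
            (Matrix.fromBlocks
              !![(1 + β) ^ 2 * μ / 2, -(β * (1 + β) * μ) / 2;
                 -(β * (1 + β) * μ) / 2, β ^ 2 * μ / 2]
              !![-(1 + β) / 2; β / 2] !![-(1 + β) / 2, β / 2]
              !![α * (1 + lamN - L * α) / 2]) -
          Matrix.fromBlocks
            ((!![1 + β, -β; 1, 0])ᵀ * Pt * !![1 + β, -β; 1, 0] - ρ ^ 2 • Pt)
            ((!![1 + β, -β; 1, 0])ᵀ * Pt * !![-α; (0 : ℝ)])
            ((!![-α; (0 : ℝ)])ᵀ * Pt * !![1 + β, -β; 1, 0])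
            ((!![-α; (0 : ℝ)])ᵀ * Pt * !![-α; (0 : ℝ)])).PosSemidef)
    {Φ : E → ℝ} {G : E → E}
    (hlower : ∀ y z, Φ y + ⟪G y, z - y⟫ + μ / 2 * ‖z - y‖ ^ 2 ≤ Φ z)
    (hupper : ∀ y z, Φ z ≤ Φ y + ⟪G y, z - y⟫ + c / 2 * ‖z - y‖ ^ 2)
    (s a b y v w : E) (hy : y = s + ((1 + β) • a - β • b)) (hv : v = y - s - α • G y - α • w) :
    Pt 0 0 * ⟪v, v⟫ + Pt 0 1 * ⟪v, a⟫ + Pt 1 0 * ⟪a, v⟫ + Pt 1 1 * ⟪a, a⟫ + Φ (v + s) - Φ s ≤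
      ρ ^ 2 * (Pt 0 0 * ⟪a, a⟫ + Pt 0 1 * ⟪a, b⟫ + Pt 1 0 * ⟪b, a⟫ + Pt 1 1 * ⟪b, b⟫
        + Φ (a + s) - Φ s) +
      ⟪-(2 * α * Pt 0 0) • (y - s - α • G y) - (α * (Pt 0 1 + Pt 1 0)) • a
        + (c * α ^ 2 - α) • G y, w⟫ +
      α ^ 2 * (Pt 0 0 + c / 2) * ‖w‖ ^ 2 := by
  obtain rfl : lamN = 1 + α * L - c * α := by linarith
  have h1 := hMI.sum_mul_inner_nonneg (Sum.elim ![a, b] ![G y])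
  have h2 := hupper y (v + s)
  have h3 := mul_le_mul_of_nonneg_left (hlower y (a + s)) (sq_nonneg ρ)
  have h4 := mul_le_mul_of_nonneg_left (hlower y s) (sub_nonneg.2 hρ)
  have e1 : v + s - y = -(α • G y) - α • w := by rw [hv]; abel
  have e2 : a + s - y = β • b - β • a := by rw [hy, add_smul, one_smul]; abel
  have e3 : s - y = β • b - (1 + β) • a := by rw [hy]; abel
  have e4 : y - s = (1 + β) • a - β • b := by rw [hy]; abel
  rw [e1] at h2
  rw [e2] at h3
  rw [e3] at h4
  rw [e4] at hv
  rw [e4]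
  generalize Φ (v + s) = p1 at *
  generalize Φ (a + s) = p2 at *
  generalize Φ s = p3 at *
  generalize Φ y = p4 at *
  generalize G y = g at *
  subst hv
  simp only [Fintype.sum_sum_type, Fin.sum_univ_two, Fin.isValue, Finset.univ_unique,
    Fin.default_eq_zero, Finset.sum_singleton, Sum.elim_inl, Sum.elim_inr, Matrix.sub_apply,
    Matrix.add_apply, Matrix.smul_apply, Matrix.fromBlocks_apply₁₁, Matrix.fromBlocks_apply₁₂,
    Matrix.fromBlocks_apply₂₁, Matrix.fromBlocks_apply₂₂, Matrix.mul_apply, Matrix.of_apply,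
    Matrix.transpose_apply, Matrix.cons_val_zero, Matrix.cons_val_one, Matrix.cons_val',
    Matrix.cons_val_fin_one, smul_eq_mul] at h1
  simp only [← real_inner_self_eq_norm_sq, inner_add_left, inner_sub_left,
    inner_sub_right, real_inner_smul_left, real_inner_smul_right, inner_neg_left,
    inner_neg_right, real_inner_comm a b, real_inner_comm a g, real_inner_comm a w,
    real_inner_comm b g, real_inner_comm b w, real_inner_comm g w] at h1 h2 h3 h4 ⊢
  linear_combination h1 + h2 + h3 + h4

theorem continuous_penObj {N d : ℕ} {W : Matrix (Fin N) (Fin N) ℝ} {α : ℝ}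
    {f : Fin N → EuclideanSpace ℝ (Fin d) → ℝ} (hf : ∀ i, Continuous (f i)) :
    Continuous (penObj W α f) := by
  unfold penObj
  fun_prop

theorem continuous_penGrad {N d : ℕ} {W : Matrix (Fin N) (Fin N) ℝ} {α : ℝ}
    {gradf : Fin N → EuclideanSpace ℝ (Fin d) → EuclideanSpace ℝ (Fin d)}
    (hg : ∀ i, Continuous (gradf i)) : Continuous (penGrad W α gradf) := by
  unfold penGrad
  fun_prop

theorem MeasureTheory.MemLp.integrable_real_inner {Ω E : Type*} {mΩ : MeasurableSpace Ω}
    {P : Measure Ω} [NormedAddCommGroup E] [InnerProductSpace ℝ E] {u w : Ω → E}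
    (hu : MemLp u 2 P) (hw : MemLp w 2 P) : Integrable (fun ω => ⟪u ω, w ω⟫) P := by
  refine (hu.norm.integrable_mul hw.norm).mono' (hu.1.inner hw.1) (ae_of_all _ fun ω => ?_)
  exact norm_inner_le_norm (𝕜 := ℝ) (u ω) (w ω)

theorem integral_inner_eq_zero_of_condExp_eq_zero {Ω E : Type*} {m mΩ : MeasurableSpace Ω}
    {P : Measure Ω} [IsProbabilityMeasure P] [NormedAddCommGroup E] [InnerProductSpace ℝ E]
    [CompleteSpace E] (hm : m ≤ mΩ) {u w : Ω → E} (hum : StronglyMeasurable[m] u)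
    (hu : MemLp u 2 P) (hw : MemLp w 2 P) (hw0 : P[w|m] =ᵐ[P] 0) :
    ∫ ω, ⟪u ω, w ω⟫ ∂P = 0 := by
  have h := condExp_bilin_of_stronglyMeasurable_left (innerSL ℝ : E →L[ℝ] E →L[ℝ] ℝ) hum
    (hu.integrable_real_inner hw) (hw.integrable one_le_two)
  rw [← integral_condExp hm, ← integral_zero Ω ℝ (μ := P)]
  refine integral_congr_ae ?_
  filter_upwards [h, hw0] with ω h1 h2
  exact h1.trans (by simp [h2])

theorem le_geometric_of_le_mul_add {r κ : ℝ} (hr0 : 0 ≤ r) (hr1 : r < 1) (hκ : 0 ≤ κ)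
    {v : ℕ → ℝ} (hv : ∀ k, v (k + 1) ≤ r * v k + κ) (k : ℕ) :
    v k ≤ r ^ k * v 0 + 1 / (1 - r) * κ := by
  have h1 : 0 < 1 - r := sub_pos.2 hr1
  induction k with
  | zero =>
    have : 0 ≤ 1 / (1 - r) * κ := by positivity
    simpa using this
  | succ k ih =>
    have h2 : r * (1 / (1 - r) * κ) + κ = 1 / (1 - r) * κ := by
      field_simp
      ring
    calc v (k + 1) ≤ r * v k + κ := hv k
      _ ≤ r * (r ^ k * v 0 + 1 / (1 - r) * κ) + κ := by gcongr
      _ = r ^ (k + 1) * v 0 + 1 / (1 - r) * κ := by rw [mul_add, add_assoc, h2]; ring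

/-- A second moment bound for a two-step stochastic recursion admitting a Lyapunov function which
contracts up to a centered cross term and a multiple of the squared norm of the noise. -/
theorem integral_norm_sq_le_of_lyapunov {Ω E : Type*} {mΩ : MeasurableSpace Ω}
    {P : Measure Ω} [IsProbabilityMeasure P] [NormedAddCommGroup E] [InnerProductSpace ℝ E]
    [CompleteSpace E] {V : E → E → ℝ} {T U : E → E → E} {α μ r κ S : ℝ}
    (hμ : 0 < μ) (hr0 : 0 ≤ r) (hr1 : r < 1) (hκ : 0 ≤ κ) (hS : 0 ≤ S)
    (hUc : Continuous fun p : E × E => U p.1 p.2)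
    (hV : ∀ a b, μ / 2 * ‖a‖ ^ 2 ≤ V a b)
    (hVint : ∀ a b : Ω → E, MemLp a 2 P → MemLp b 2 P → Integrable (fun ω => V (a ω) (b ω)) P)
    (hTint : ∀ a b : Ω → E, MemLp a 2 P → MemLp b 2 P → MemLp (fun ω => T (a ω) (b ω)) 2 P)
    (hUint : ∀ a b : Ω → E, MemLp a 2 P → MemLp b 2 P → MemLp (fun ω => U (a ω) (b ω)) 2 P)
    (hstep : ∀ a b w, V (T a b - α • w) a ≤ r * V a b + ⟪U a b, w⟫ + κ * ‖w‖ ^ 2)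
    {ℱ : ℕ → MeasurableSpace Ω} (hℱ : ∀ k, ℱ k ≤ mΩ)
    {A B w : ℕ → Ω → E} {a₀ b₀ : E} (hA0 : ∀ ω, A 0 ω = a₀) (hB0 : ∀ ω, B 0 ω = b₀)
    (hB : ∀ k ω, B (k + 1) ω = A k ω)
    (hA : ∀ k ω, A (k + 1) ω = T (A k ω) (B k ω) - α • w (k + 1) ω)
    (hAm : ∀ k, StronglyMeasurable[ℱ k] (A k)) (hBm : ∀ k, StronglyMeasurable[ℱ k] (B k))
    (hw : ∀ k, MemLp (w (k + 1)) 2 P) (hwmean : ∀ k, P[w (k + 1)|ℱ k] =ᵐ[P] 0)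
    (hwvar : ∀ k, ∀ᵐ ω ∂P, (P[fun ω' => ‖w (k + 1) ω'‖ ^ 2|ℱ k]) ω ≤ S) (k : ℕ) :
    ∫ ω, ‖A k ω‖ ^ 2 ∂P ≤ r ^ k * (2 * V a₀ b₀ / μ) + 1 / (1 - r) * (2 * (κ * S) / μ) := by
  have hL2 : ∀ k, MemLp (A k) 2 P ∧ MemLp (B k) 2 P := by
    intro k
    induction k with
    | zero =>
      rw [funext hA0, funext hB0]
      exact ⟨memLp_const _, memLp_const _⟩
    | succ k ih =>
      rw [funext (hA k), funext (hB k)]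
      exact ⟨(hTint _ _ ih.1 ih.2).sub ((hw k).const_smul α), ih.1⟩
  have hVk : ∀ k, Integrable (fun ω => V (A k ω) (B k ω)) P := fun k =>
    hVint _ _ (hL2 k).1 (hL2 k).2
  have hwsq : ∀ k, Integrable (fun ω => ‖w (k + 1) ω‖ ^ 2) P := fun k => (hw k).norm.integrable_sq
  have hrec : ∀ k, ∫ ω, V (A (k + 1) ω) (B (k + 1) ω) ∂P
      ≤ r * (∫ ω, V (A k ω) (B k ω) ∂P) + κ * S := by
    intro k
    have hU2 := hUint _ _ (hL2 k).1 (hL2 k).2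
    have hUw := hU2.integrable_real_inner (hw k)
    have hUm : StronglyMeasurable[ℱ k] fun ω => U (A k ω) (B k ω) :=
      hUc.comp_stronglyMeasurable ((hAm k).prodMk (hBm k))
    have hnoise : ∫ ω, ‖w (k + 1) ω‖ ^ 2 ∂P ≤ S := by
      rw [← integral_condExp (hℱ k)]
      refine (integral_mono_ae integrable_condExp (integrable_const S) (hwvar k)).trans ?_
      simp
    calc ∫ ω, V (A (k + 1) ω) (B (k + 1) ω) ∂P
        ≤ ∫ ω, (r * V (A k ω) (B k ω) + ⟪U (A k ω) (B k ω), w (k + 1) ω⟫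
            + κ * ‖w (k + 1) ω‖ ^ 2) ∂P := by
          refine integral_mono (hVk _) ((((hVk k).const_mul r).add hUw).add
            ((hwsq k).const_mul κ)) fun ω => ?_
          simp only [hA k ω, hB k ω]
          exact hstep _ _ _
      _ = r * (∫ ω, V (A k ω) (B k ω) ∂P) + κ * ∫ ω, ‖w (k + 1) ω‖ ^ 2 ∂P := by
          rw [integral_add (f := fun ω => _ + _) (((hVk k).const_mul r).add hUw)
              ((hwsq k).const_mul κ), integral_add ((hVk k).const_mul r) hUw, integral_const_mul,
            integral_const_mul, integral_inner_eq_zero_of_condExp_eq_zero (hℱ k) hUm hU2 (hw k)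
              (hwmean k), add_zero]
      _ ≤ _ := by gcongr
  have hgeo := le_geometric_of_le_mul_add (v := fun k => ∫ ω, V (A k ω) (B k ω) ∂P) hr0 hr1
    (mul_nonneg hκ hS) hrec k
  have hle : μ / 2 * ∫ ω, ‖A k ω‖ ^ 2 ∂P ≤ ∫ ω, V (A k ω) (B k ω) ∂P := by
    rw [← integral_const_mul]
    exact integral_mono ((hL2 k).1.norm.integrable_sq.const_mul _) (hVk k) fun ω => hV _ _
  have hzero : ∫ ω, V (A 0 ω) (B 0 ω) ∂P = V a₀ b₀ := by simp [hA0, hB0]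
  simp only [hzero] at hgeo
  calc ∫ ω, ‖A k ω‖ ^ 2 ∂P = 2 / μ * (μ / 2 * ∫ ω, ‖A k ω‖ ^ 2 ∂P) := by field_simp
    _ ≤ 2 / μ * (r ^ k * V a₀ b₀ + 1 / (1 - r) * (κ * S)) := by
        gcongr
        exact hle.trans hgeo
    _ = _ := by ring

/-- A gradient which vanishes at a minimizer grows at most linearly under quadratic upper
bounds. -/
theorem norm_le_mul_norm_sub_of_quadratic_bounds {E : Type*} [NormedAddCommGroup E]
    [InnerProductSpace ℝ E] {Φ : E → ℝ} {G : E → E} {c : ℝ} {s : E} (hc : 0 < c) (hs : G s = 0)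
    (hmin : ∀ z, Φ s ≤ Φ z)
    (hupper : ∀ y z, Φ z ≤ Φ y + ⟪G y, z - y⟫ + c / 2 * ‖z - y‖ ^ 2) (y : E) :
    ‖G y‖ ≤ c * ‖y - s‖ := by
  have h1 := hupper s y
  have h2 := (hmin _).trans (hupper y (y - c⁻¹ • G y))
  rw [sub_sub_cancel_left, inner_neg_right, norm_neg, norm_smul, real_inner_smul_right,
    real_inner_self_eq_norm_sq, Real.norm_of_nonneg (inv_pos.2 hc).le] at h2
  rw [hs, inner_zero_left] at h1
  refine abs_le_of_sq_le_sq' ?_ (by positivity) |>.2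
  have h3 : c / 2 * (c⁻¹ * ‖G y‖) ^ 2 = c⁻¹ / 2 * ‖G y‖ ^ 2 := by field_simp
  rw [h3] at h2
  have h4 : c⁻¹ / 2 * ‖G y‖ ^ 2 ≤ c / 2 * ‖y - s‖ ^ 2 := by linarith
  have h5 := mul_le_mul_of_nonneg_left h4 (by positivity : 0 ≤ 2 * c)
  calc ‖G y‖ ^ 2 = 2 * c * (c⁻¹ / 2 * ‖G y‖ ^ 2) := by field_simp
    _ ≤ _ := h5
    _ = _ := by ring

/-- **Theorem (D-ASG, convergence via a matrix inequality).**  If there are `ρ ∈ (0,1)` and a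
positive semidefinite `2×2` matrix `P̃` satisfying the matrix inequality (20) of the paper, then
the D-ASG iterates satisfy
`E[‖x^{(k)} − x^∞‖²] ≤ ρ^{2k}·2V_{P,α,1}(ξ₀)/μ
  + (1/(1−ρ²))·(2α²σ²N/μ)·(P̃₁₁ + (1−λ_N^W+αL)/(2α))`. -/
theorem dasg_convergence_via_LMI
    {N d : ℕ} (hN : 0 < N) (hd : 0 < d)
    (μ L α β σ ρ : ℝ) (hμ : 0 < μ) (hμL : μ ≤ L) (hσ : 0 ≤ σ)
    (hα0 : 0 < α) (hβ : 0 ≤ β) (hρ0 : 0 < ρ) (hρ1 : ρ < 1)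
    -- the symmetric doubly stochastic mixing matrix and its eigenvalues, in decreasing order
    (W : Matrix (Fin N) (Fin N) ℝ)
    (hWsymm : W.IsSymm)
    (hWnonneg : ∀ i j, 0 ≤ W i j)
    (hWrow : ∀ i, ∑ j, W i j = 1)
    (hWcol : ∀ j, ∑ i, W i j = 1)
    (lam : Fin N → ℝ) (V : Matrix (Fin N) (Fin N) ℝ)
    (hV : V * Vᵀ = 1)
    (hWeig : W = Vᵀ * Matrix.diagonal lam * V)
    (hlamAnti : Antitone lam)
    (hlamTop : lam ⟨0, hN⟩ = 1)
    (lamN : ℝ) (hlamN : lamN = lam ⟨N - 1, Nat.sub_lt hN Nat.one_pos⟩)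
    -- the matrix P̃ and the matrix inequality
    (Pt : Matrix (Fin 2) (Fin 2) ℝ) (hPt : Pt.PosSemidef)
    (hMI :
      (ρ ^ 2 •
            (Matrix.fromBlocks
              !![β ^ 2 * μ / 2, -(β ^ 2 * μ) / 2; -(β ^ 2 * μ) / 2, β ^ 2 * μ / 2]
              !![-β / 2; β / 2] !![-β / 2, β / 2] !![α * (1 + lamN - L * α) / 2]) +
          (1 - ρ ^ 2) •
            (Matrix.fromBlocks
              !![(1 + β) ^ 2 * μ / 2, -(β * (1 + β) * μ) / 2;
                 -(β * (1 + β) * μ) / 2, β ^ 2 * μ / 2]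
              !![-(1 + β) / 2; β / 2] !![-(1 + β) / 2, β / 2]
              !![α * (1 + lamN - L * α) / 2]) -
          Matrix.fromBlocks
            ((!![1 + β, -β; 1, 0])ᵀ * Pt * !![1 + β, -β; 1, 0] - ρ ^ 2 • Pt)
            ((!![1 + β, -β; 1, 0])ᵀ * Pt * !![-α; (0 : ℝ)])
            ((!![-α; (0 : ℝ)])ᵀ * Pt * !![1 + β, -β; 1, 0])
            ((!![-α; (0 : ℝ)])ᵀ * Pt * !![-α; (0 : ℝ)])).PosSemidef)
    -- the local objectives: μ-strongly convex with L-Lipschitz gradients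
    (f : Fin N → EuclideanSpace ℝ (Fin d) → ℝ)
    (gradf : Fin N → EuclideanSpace ℝ (Fin d) → EuclideanSpace ℝ (Fin d))
    (hgrad : ∀ i x, HasGradientAt (f i) (gradf i x) x)
    (hlip : ∀ i, LipschitzWith (Real.toNNReal L) (gradf i))
    (hconv : ∀ i, ConvexOn ℝ Set.univ (fun x => f i x - μ / 2 * ‖x‖ ^ 2))
    -- the fixed point x^∞ : solution of (I − 𝒲)x + α ∇F(x) = 0
    (xinf : PiLp 2 (fun _ : Fin N => EuclideanSpace ℝ (Fin d)))
    (hxinf : ∀ i, (xinf i - ∑ j, W i j • xinf j) + α • gradf i (xinf i) = 0)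
    -- probability space, filtration and the D-ASG iterates
    {Ω : Type} {mΩ : MeasurableSpace Ω} (P : Measure Ω) [IsProbabilityMeasure P]
    (ℱ : ℕ → MeasurableSpace Ω) (hℱ : ∀ k, ℱ k ≤ mΩ) (hℱmono : Monotone ℱ)
    (X Y w : ℕ → Ω → PiLp 2 (fun _ : Fin N => EuclideanSpace ℝ (Fin d)))
    (x0 xm1 : PiLp 2 (fun _ : Fin N => EuclideanSpace ℝ (Fin d)))
    (hX0 : ∀ ω, X 0 ω = x0)
    (hY0 : ∀ ω i, Y 0 ω i = (1 + β) • x0 i - β • xm1 i)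
    (hYS : ∀ k ω i, Y (k + 1) ω i = (1 + β) • X (k + 1) ω i - β • X k ω i)
    (hXadapted : ∀ k, StronglyMeasurable[ℱ k] (X k))
    (hwmeas : ∀ k, StronglyMeasurable[ℱ (k + 1)] (w (k + 1)))
    (hrec : ∀ k ω i, X (k + 1) ω i =
      (∑ j, W i j • Y k ω j) - α • gradf i (Y k ω i) - α • w (k + 1) ω i)
    -- the gradient noise: conditionally centered with conditional variance ≤ σ²N
    (hwmean : ∀ k, P[w (k + 1)|ℱ k] =ᵐ[P] 0)
    (hwL2 : ∀ k, Integrable (fun ω => ‖w (k + 1) ω‖ ^ 2) P)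
    (hwvar : ∀ k, ∀ᵐ ω ∂P, (P[fun ω' => ‖w (k + 1) ω'‖ ^ 2|ℱ k]) ω ≤ σ ^ 2 * N) :
    ∀ k : ℕ,
      ∫ ω, ‖X k ω - xinf‖ ^ 2 ∂P ≤
        ρ ^ (2 * k) * (2 * lyapP W α Pt f xinf (x0 - xinf) (xm1 - xinf) / μ) +
          1 / (1 - ρ ^ 2) * (2 * α ^ 2 * σ ^ 2 * N / μ) *
            (Pt 0 0 + (1 - lamN + α * L) / (2 * α)) := by
  have hLnn : ((Real.toNNReal L : ℝ≥0) : ℝ) = L := Real.coe_toNNReal _ (hμ.le.trans hμL)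
  set c : ℝ := (1 - lamN) / α + (Real.toNNReal L : ℝ≥0) with hc
  have hVV : Vᵀ * V = 1 := mul_eq_one_comm.1 hV
  have hlam1 : ∀ i, lam i ≤ 1 := fun i =>
    hlamTop ▸ hlamAnti (Nat.zero_le i.1 : (⟨0, hN⟩ : Fin N) ≤ i)
  have hlamge : ∀ i, lamN ≤ lam i := fun i => by
    rw [hlamN]
    exact hlamAnti (Nat.le_sub_one_of_lt i.2 : i ≤ ⟨N - 1, Nat.sub_lt hN Nat.one_pos⟩)
  have hW1 : (1 - W).PosSemidef := by
    have h := posSemidef_transpose_mul_diagonal_mul (V := V) (c := fun i => 1 - lam i)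
      fun i => sub_nonneg.2 (hlam1 i)
    rwa [← Matrix.diagonal_sub, Matrix.mul_sub, Matrix.sub_mul, ← hWeig, Matrix.diagonal_one,
      Matrix.mul_one, hVV] at h
  have hWl : (W - lamN • 1).PosSemidef := by
    have h := posSemidef_transpose_mul_diagonal_mul (V := V) (c := fun i => lam i - lamN)
      fun i => sub_nonneg.2 (hlamge i)
    rwa [← Matrix.diagonal_sub, Matrix.mul_sub, Matrix.sub_mul, ← hWeig,
      ← Matrix.smul_one_eq_diagonal, Matrix.mul_smul, Matrix.smul_mul, Matrix.mul_one, hVV] at h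
  have hc0 : 0 < c := by
    have h1 : 0 ≤ (1 - lamN) / α :=
      div_nonneg (sub_nonneg.2 ((hlamge ⟨0, hN⟩).trans (hlam1 _))) hα0.le
    rw [hc, hLnn]
    linarith
  have hcα : c * α = 1 - lamN + α * L := by
    rw [hc, hLnn]
    field_simp
  set Φ := penObj W α f with hΦ
  set G := penGrad W α gradf with hG
  have hlower : ∀ y z, Φ y + ⟪G y, z - y⟫ + μ / 2 * ‖z - y‖ ^ 2 ≤ Φ z :=
    add_inner_add_sq_le_penObj hWsymm hW1 hα0 hgrad hconv
  have hupper : ∀ y z, Φ z ≤ Φ y + ⟪G y, z - y⟫ + c / 2 * ‖z - y‖ ^ 2 :=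
    penObj_le_add_inner_add_sq hWsymm hWl hα0 hgrad hlip
  have hGs : G xinf = 0 := by
    refine PiLp.ext fun i => ?_
    have h := congrArg ((1 / α) • ·) (hxinf i)
    simpa [hG, penGrad, smul_smul, hα0.ne'] using h
  have hsc : ∀ z, μ / 2 * ‖z - xinf‖ ^ 2 ≤ Φ z - Φ xinf := fun z => by
    have h := hlower xinf z
    rw [hGs, inner_zero_left] at h
    linarith
  have hmin : ∀ z, Φ xinf ≤ Φ z := fun z => by
    have h := hsc z
    have : 0 ≤ μ / 2 * ‖z - xinf‖ ^ 2 := by positivity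
    linarith
  have hGle := norm_le_mul_norm_sub_of_quadratic_bounds hc0 hGs hmin hupper
  have hΦle : ∀ z, Φ z - Φ xinf ≤ c / 2 * ‖z - xinf‖ ^ 2 := fun z => by
    have h := hupper xinf z
    rw [hGs, inner_zero_left] at h
    linarith
  have hΦc : Continuous Φ := continuous_penObj fun i =>
    continuous_iff_continuousAt.2 fun x => (hgrad i x).continuousAt
  have hGc : Continuous G := continuous_penGrad fun i => (hlip i).continuous
  have hGint : ∀ u : Ω → PiLp 2 (fun _ : Fin N => EuclideanSpace ℝ (Fin d)), MemLp u 2 P →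
      MemLp (fun ω => G (xinf + u ω)) 2 P := fun u hu =>
    hu.of_le_mul (c := c) ((hGc.comp (continuous_const_add xinf)).comp_aestronglyMeasurable hu.1)
      (ae_of_all _ fun ω => by simpa using hGle (xinf + u ω))
  have hmom : ∀ a b : Ω → PiLp 2 (fun _ : Fin N => EuclideanSpace ℝ (Fin d)), MemLp a 2 P →
      MemLp b 2 P → MemLp (fun ω => (1 + β) • a ω - β • b ω) 2 P := fun a b ha hb =>
    (ha.const_smul (1 + β)).sub (hb.const_smul β)
  set B : ℕ → Ω → PiLp 2 (fun _ : Fin N => EuclideanSpace ℝ (Fin d)) := fun k ω =>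
    Nat.casesOn k (xm1 - xinf) fun j => X j ω - xinf
  have hYeq : ∀ k ω, Y k ω = xinf + ((1 + β) • (X k ω - xinf) - β • B k ω) := by
    intro k ω
    refine PiLp.ext fun i => ?_
    cases k with
    | zero =>
      rw [show B 0 ω = xm1 - xinf from rfl]
      simp only [hY0, hX0, PiLp.add_apply, PiLp.sub_apply, PiLp.smul_apply]
      module
    | succ k =>
      rw [show B (k + 1) ω = X k ω - xinf from rfl]
      simp only [hYS, PiLp.add_apply, PiLp.sub_apply, PiLp.smul_apply]
      module
  have hstep : ∀ a b w, lyapP W α Pt f xinf (xinf + ((1 + β) • a - β • b) - xinf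
      - α • G (xinf + ((1 + β) • a - β • b)) - α • w) a ≤ ρ ^ 2 * lyapP W α Pt f xinf a b +
      ⟪-(2 * α * Pt 0 0) • (xinf + ((1 + β) • a - β • b) - xinf
        - α • G (xinf + ((1 + β) • a - β • b))) - (α * (Pt 0 1 + Pt 1 0)) • a
        + (c * α ^ 2 - α) • G (xinf + ((1 + β) • a - β • b)), w⟫ +
      α ^ 2 * (Pt 0 0 + c / 2) * ‖w‖ ^ 2 := by
    intro a b w
    have hρ : ρ ^ 2 ≤ 1 := by nlinarith
    exact lyapunov_step_le hρ hcα hMI hlower hupper xinf a b (xinf + ((1 + β) • a - β • b))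
      (xinf + ((1 + β) • a - β • b) - xinf - α • G (xinf + ((1 + β) • a - β • b)) - α • w) w
      rfl rfl
  intro k
  have hPt0 : 0 ≤ Pt 0 0 := by simpa using hPt.diag_nonneg (i := 0)
  have key := integral_norm_sq_le_of_lyapunov (P := P) (V := lyapP W α Pt f xinf)
    (T := fun a b => (xinf + ((1 + β) • a - β • b)) - xinf
      - α • G (xinf + ((1 + β) • a - β • b)))
    (U := fun a b => -(2 * α * Pt 0 0) • (xinf + ((1 + β) • a - β • b) - xinf
        - α • G (xinf + ((1 + β) • a - β • b))) - (α * (Pt 0 1 + Pt 1 0)) • a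
        + (c * α ^ 2 - α) • G (xinf + ((1 + β) • a - β • b)))
    (α := α) (μ := μ) (r := ρ ^ 2) (κ := α ^ 2 * (Pt 0 0 + c / 2)) (S := σ ^ 2 * N)
    hμ (sq_nonneg ρ) (by nlinarith) (by positivity) (by positivity) (by fun_prop)
    (fun a b => by
      have h1 := hPt.sum_mul_inner_nonneg ![a, b]
      simp only [Fin.sum_univ_two, Fin.isValue, Matrix.cons_val_zero, Matrix.cons_val_one] at h1
      have h2 := hsc (a + xinf)
      rw [add_sub_cancel_right] at h2
      rw [lyapP]
      linarith)
    (fun a b ha hb => by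
      have h1 : Integrable (fun ω => Φ (a ω + xinf) - Φ xinf) P := by
        refine (ha.norm.integrable_sq.const_mul (c / 2)).mono'
          (((hΦc.comp (continuous_add_const xinf)).sub
            continuous_const).comp_aestronglyMeasurable ha.1) (ae_of_all _ fun ω => ?_)
        rw [Real.norm_of_nonneg (sub_nonneg.2 (hmin _))]
        simpa using hΦle (a ω + xinf)
      have h2 := (((((ha.integrable_real_inner ha).const_mul (Pt 0 0)).add
        ((ha.integrable_real_inner hb).const_mul (Pt 0 1))).add
        ((hb.integrable_real_inner ha).const_mul (Pt 1 0))).add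
        ((hb.integrable_real_inner hb).const_mul (Pt 1 1))).add h1
      refine h2.congr (ae_of_all _ fun ω => ?_)
      simp only [lyapP, Pi.add_apply]
      ring)
    (fun a b ha hb => by
      simp only [add_sub_cancel_left]
      exact (hmom a b ha hb).sub ((hGint _ (hmom a b ha hb)).const_smul α))
    (fun a b ha hb => by
      simp only [add_sub_cancel_left]
      have hg := hGint _ (hmom a b ha hb)
      exact ((((hmom a b ha hb).sub (hg.const_smul α)).const_smul (-(2 * α * Pt 0 0))).sub
        (ha.const_smul (α * (Pt 0 1 + Pt 1 0)))).add (hg.const_smul (c * α ^ 2 - α)))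
    hstep
    hℱ (A := fun k ω => X k ω - xinf) (B := B) (w := w) (a₀ := x0 - xinf) (b₀ := xm1 - xinf)
    (fun ω => by simp only [hX0]) (fun ω => rfl) (fun k ω => rfl)
    (fun k ω => by
      rw [← hYeq]
      refine PiLp.ext fun i => ?_
      simp only [PiLp.sub_apply, PiLp.smul_apply, hrec, hG, penGrad, smul_add, smul_smul,
        mul_one_div_cancel hα0.ne', one_smul]
      abel)
    (fun k => (hXadapted k).sub stronglyMeasurable_const)
    (fun k => by
      cases k with
      | zero => exact stronglyMeasurable_const
      | succ k => exact ((hXadapted k).mono (hℱmono k.le_succ)).sub stronglyMeasurable_const)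
    (fun k => (memLp_two_iff_integrable_sq_norm
      ((hwmeas k).mono (hℱ (k + 1))).aestronglyMeasurable).2 (hwL2 k))
    hwmean hwvar k
  refine key.trans (le_of_eq ?_)
  have h5 : (1 - lamN + α * L) / (2 * α) = c / 2 := by
    rw [← hcα]
    field_simp
  rw [h5, pow_mul]
  ring
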